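/- Let σ ∈ S_n², let (i,j) and (i',j') be arcs of σ with j' < i, and suppose every integer p with j' < p < i is an endpoint of some arc (a,b) of σ with i' ≤ a < b ≤ j. Let σ'' be the involution obtained from σ by replacing the two arcs (i',j'), (i,j) with the arcs (i',i) and (j',j). Then σ'' ≺ σ, f(σ'') = f(σ), and c(σ'') = c(σ) + 1. -/

import Mathlib

namespace LinkPat

variable {n : ℕ}

/-- `σ` is an involution (σ² = id). -/
def IsInvol (σ : Equiv.Perm (Fin n)) : Prop := ∀ p, σ (σ p) = p

/-- `(i,j)` is an arc of `σ`: `i < j` and `σ i = j`. -/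
def IsArc (σ : Equiv.Perm (Fin n)) (i j : Fin n) : Prop := i < j ∧ σ i = j

/-- The finite set of arcs of `σ`. -/
def arcs (σ : Equiv.Perm (Fin n)) : Finset (Fin n × Fin n) :=
  Finset.univ.filter fun a => a.1 < a.2 ∧ σ a.1 = a.2

/-- The number of arcs of `σ`. -/
def numArcs (σ : Equiv.Perm (Fin n)) : ℕ := (arcs σ).card

/-- `c(σ)`: the number of crossings, i.e. pairs of arcs `(i,j)`, `(i',j')` with
`i < i' < j < j'`. -/
def crossNum (σ : Equiv.Perm (Fin n)) : ℕ :=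
  ((arcs σ ×ˢ arcs σ).filter fun x => x.1.1 < x.2.1 ∧ x.2.1 < x.1.2 ∧ x.1.2 < x.2.2).card

/-- `f(σ)`: the sum over fixed points `p` of the number of arcs over `p`. -/
def fixNum (σ : Equiv.Perm (Fin n)) : ℕ :=
  (((Finset.univ.filter fun p => σ p = p) ×ˢ arcs σ).filter
    fun x => x.2.1 < x.1 ∧ x.1 < x.2.2).card

/-- The rank matrix `R_σ`: entry `(i,j)` is the number of arcs inside `[i,j]`. -/
def Rmat (σ : Equiv.Perm (Fin n)) (i j : Fin n) : ℕ :=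
  ((arcs σ).filter fun a => i ≤ a.1 ∧ a.2 ≤ j).card

/-- The partial order `σ' ⪯ σ` given by pointwise comparison of rank matrices. -/
def rle (σ' σ : Equiv.Perm (Fin n)) : Prop := ∀ i j, Rmat σ' i j ≤ Rmat σ i j

/-- The strict order `σ' ≺ σ`. -/
def rlt (σ' σ : Equiv.Perm (Fin n)) : Prop := rle σ' σ ∧ σ' ≠ σ

end LinkPat

namespace LinkPat

variable {n : ℕ}

theorem mem_arcs {σ : Equiv.Perm (Fin n)} {x : Fin n × Fin n} :
    x ∈ arcs σ ↔ x.1 < x.2 ∧ σ x.1 = x.2 := by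
  simp [arcs]

/-- The arcs `x` and `y` cross, `x` being the one that starts first. -/
abbrev Crosses (x y : Fin n × Fin n) : Prop := x.1 < y.1 ∧ y.1 < x.2 ∧ x.2 < y.2

/-- The arcs of `σ` starting neither at `a` nor at `c`. -/
def arcsAvoiding (σ : Equiv.Perm (Fin n)) (a c : Fin n) : Finset (Fin n × Fin n) :=
  (arcs σ).filter fun x => x.1 ≠ a ∧ x.1 ≠ c

theorem mem_arcsAvoiding {σ : Equiv.Perm (Fin n)} {a c : Fin n} {x : Fin n × Fin n} :
    x ∈ arcsAvoiding σ a c ↔ (x.1 < x.2 ∧ σ x.1 = x.2) ∧ x.1 ≠ a ∧ x.1 ≠ c := by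
  simp [arcsAvoiding, mem_arcs]

theorem crossNum_eq_sum (σ : Equiv.Perm (Fin n)) :
    crossNum σ = ∑ x ∈ arcs σ, ∑ y ∈ arcs σ, if Crosses x y then 1 else 0 := by
  rw [crossNum, Finset.card_filter, Finset.sum_product]

theorem fixNum_eq_sum (σ : Equiv.Perm (Fin n)) :
    fixNum σ = ∑ p ∈ Finset.univ.filter (fun p => σ p = p), ∑ x ∈ arcs σ,
      if x.1 < p ∧ p < x.2 then 1 else 0 := by
  rw [fixNum, Finset.card_filter, Finset.sum_product]

theorem Rmat_eq_sum (σ : Equiv.Perm (Fin n)) (i j : Fin n) :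
    Rmat σ i j = ∑ x ∈ arcs σ, if i ≤ x.1 ∧ x.2 ≤ j then 1 else 0 := by
  rw [Rmat, Finset.card_filter]

/-- A double sum over a set with two distinguished elements. -/
theorem sum_sum_insert_insert {α : Type*} [DecidableEq α] {s : Finset α} {u v : α}
    (huv : u ≠ v) (hu : u ∉ s) (hv : v ∉ s) (g : α → α → ℕ) :
    ∑ x ∈ insert u (insert v s), ∑ y ∈ insert u (insert v s), g x y =
      (g u u + g u v + g v u + g v v) + ∑ y ∈ s, (g u y + g v y + g y u + g y v) +
        ∑ x ∈ s, ∑ y ∈ s, g x y := by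
  have hu' : u ∉ insert v s := by simp [huv, hu]
  simp only [Finset.sum_insert hu', Finset.sum_insert hv, Finset.sum_add_distrib]
  ring

section Swap

variable {σ : Equiv.Perm (Fin n)} {a b c d : Fin n}

theorem swap_conj_apply (hσ : IsInvol σ) (hab : σ a = b) (hcd : σ c = d) (p : Fin n)
    (hbc : b ≠ c) (hac : a ≠ c) (hab' : a ≠ b) (hcd' : c ≠ d) (hbd : b ≠ d) :
    (Equiv.swap b c * σ * Equiv.swap b c) p =
      if p = a then c else if p = b then d else if p = c then a else if p = d then b else σ p := by
  have hba : σ b = a := hab ▸ hσ a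
  have hdc : σ d = c := hcd ▸ hσ c
  have hp := hσ p
  simp only [Equiv.Perm.mul_apply, Equiv.swap_apply_def]
  grind

theorem arcs_eq_insert (hab : IsArc σ a b) (hcd : IsArc σ c d) :
    arcs σ = insert (a, b) (insert (c, d) (arcsAvoiding σ a c)) := by
  ext ⟨x, y⟩
  have := hab.1
  have := hab.2
  have := hcd.1
  have := hcd.2
  simp only [mem_arcs, Finset.mem_insert, mem_arcsAvoiding, Prod.mk.injEq]
  grind

theorem arcs_swap_conj_eq_insert (hσ : IsInvol σ) (hab : IsArc σ a b) (hcd : IsArc σ c d)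
    (hbc : b < c) :
    arcs (Equiv.swap b c * σ * Equiv.swap b c) =
      insert (a, c) (insert (b, d) (arcsAvoiding σ a c)) := by
  obtain ⟨hab, hab'⟩ := hab
  obtain ⟨hcd, hcd'⟩ := hcd
  have hba : σ b = a := hab' ▸ hσ a
  have hdc : σ d = c := hcd' ▸ hσ c
  ext ⟨x, y⟩
  simp only [mem_arcs, Finset.mem_insert, mem_arcsAvoiding, Prod.mk.injEq]
  rw [swap_conj_apply hσ hab' hcd' x (by order) (by order) (by order) (by order)
    (by order)]
  grind

theorem ne_of_mem_arcsAvoiding (hσ : IsInvol σ) (hab : IsArc σ a b) (hcd : IsArc σ c d)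
    {x : Fin n × Fin n} (hx : x ∈ arcsAvoiding σ a c) :
    x.1 ≠ a ∧ x.1 ≠ b ∧ x.1 ≠ c ∧ x.1 ≠ d ∧ x.2 ≠ a ∧ x.2 ≠ b ∧ x.2 ≠ c ∧ x.2 ≠ d := by
  obtain ⟨hab, hab'⟩ := hab
  obtain ⟨hcd, hcd'⟩ := hcd
  have hba : σ b = a := hab' ▸ hσ a
  have hdc : σ d = c := hcd' ▸ hσ c
  have hx' := hσ x.1
  rw [mem_arcsAvoiding] at hx
  grind

end Swap

end LinkPat

/-- crossing an arc `(i,j)` with an arc `(i',j')` entirely to its left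
(with no free point between `j'` and `i` relative to `π_{i',j}`) produces an
involution `σ''` (with arcs `(i',i)` and `(j',j)` instead of `(i',j')`, `(i,j)`,
i.e. the conjugate of `σ` by the transposition exchanging `j'` and `i`) which is
strictly smaller, with the same `f` and with `c` increased by exactly `1`. -/
theorem cross_left_move (n : ℕ) (σ σ'' : Equiv.Perm (Fin n))
    (hσ : LinkPat.IsInvol σ) (i j i' j' : Fin n)
    (harc : LinkPat.IsArc σ i j) (harc' : LinkPat.IsArc σ i' j') (hji : j' < i)
    (hfill : ∀ p : Fin n, j' < p → p < i →
      ∃ a b : Fin n, LinkPat.IsArc σ a b ∧ i' ≤ a ∧ b ≤ j ∧ (p = a ∨ p = b))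
    (hdef : σ'' = Equiv.swap j' i * σ * Equiv.swap j' i) :
    LinkPat.rlt σ'' σ ∧ LinkPat.fixNum σ'' = LinkPat.fixNum σ ∧
      LinkPat.crossNum σ'' = LinkPat.crossNum σ + 1 := by
  subst hdef
  have harcs := LinkPat.arcs_eq_insert harc' harc
  have harcs' := LinkPat.arcs_swap_conj_eq_insert hσ harc' harc hji
  have hne := fun x hx => LinkPat.ne_of_mem_arcsAvoiding hσ harc' harc (x := x) hx
  have hnot {u v : Fin n} (hu : u = i' ∨ u = j' ∨ u = i) :
      (u, v) ∉ LinkPat.arcsAvoiding σ i' i := by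
    intro h
    have := hne _ h
    grind
  have hinside (x) (hx : x ∈ LinkPat.arcsAvoiding σ i' i)
      (h : j' < x.1 ∧ x.1 < i ∨ j' < x.2 ∧ x.2 < i) : i' ≤ x.1 ∧ x.2 ≤ j := by
    rw [LinkPat.mem_arcsAvoiding] at hx
    have hx' := hσ x.1
    rcases h with h | h <;> obtain ⟨u, v, ⟨huv, huv'⟩, h1, h2, h3⟩ := hfill _ h.1 h.2 <;>
      have hu' := hσ u <;> grind
  obtain ⟨hij, hσi⟩ := harc
  obtain ⟨hij', hσi'⟩ := harc'
  have hσj : σ j = i := hσi ▸ hσ i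
  have hσj' : σ j' = i' := hσi' ▸ hσ i'
  have hconj (p : Fin n) := LinkPat.swap_conj_apply hσ hσi' hσi p hji.ne
    (hij'.trans hji).ne hij'.ne hij.ne (hji.trans hij).ne
  refine ⟨⟨fun k l => ?_, fun h => ?_⟩, ?_, ?_⟩
  · rw [LinkPat.Rmat_eq_sum, LinkPat.Rmat_eq_sum, harcs, harcs',
      Finset.sum_insert (by simp [hnot, hij'.ne]), Finset.sum_insert (hnot (by simp)),
      Finset.sum_insert (by simp [hnot, (hij'.trans hji).ne]), Finset.sum_insert (hnot (by simp))]
    grind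
  · have := hconj i'
    rw [h, hσi', if_pos rfl] at this
    exact hji.ne this
  · have hfix : (Finset.univ.filter fun p => (Equiv.swap j' i * σ * Equiv.swap j' i) p = p) =
        Finset.univ.filter fun p => σ p = p := by
      ext p
      simp only [Finset.mem_filter, Finset.mem_univ, true_and, hconj]
      grind
    rw [LinkPat.fixNum_eq_sum, LinkPat.fixNum_eq_sum, hfix]
    refine Finset.sum_congr rfl fun p hp => ?_
    rw [Finset.mem_filter] at hp
    have hgap : ¬ (j' < p ∧ p < i) := by
      rintro ⟨h1, h2⟩
      obtain ⟨u, v, ⟨huv, huv'⟩, -, -, h⟩ := hfill p h1 h2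
      have := hσ u
      grind
    rw [harcs, harcs',
      Finset.sum_insert (by simp [hnot, hij'.ne]), Finset.sum_insert (hnot (by simp)),
      Finset.sum_insert (by simp [hnot, (hij'.trans hji).ne]), Finset.sum_insert (hnot (by simp))]
    grind
  · rw [LinkPat.crossNum_eq_sum, LinkPat.crossNum_eq_sum, harcs, harcs',
      LinkPat.sum_sum_insert_insert (by simp [hij'.ne]) (hnot (by simp)) (hnot (by simp)),
      LinkPat.sum_sum_insert_insert (by simp [(hij'.trans hji).ne]) (hnot (by simp))
        (hnot (by simp))]
    have hsum : ∀ x ∈ LinkPat.arcsAvoiding σ i' i,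
        ((if LinkPat.Crosses (i', i) x then 1 else 0) + (if LinkPat.Crosses (j', j) x then 1 else 0)
          + (if LinkPat.Crosses x (i', i) then 1 else 0)
          + (if LinkPat.Crosses x (j', j) then 1 else 0) : ℕ) =
        (if LinkPat.Crosses (i', j') x then 1 else 0) + (if LinkPat.Crosses (i, j) x then 1 else 0)
          + (if LinkPat.Crosses x (i', j') then 1 else 0)
          + (if LinkPat.Crosses x (i, j) then 1 else 0) := by
      intro x hx
      have h1 := hne x hx
      have h2 := hinside x hx
      have h3 := (LinkPat.mem_arcsAvoiding.mp hx).1.1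
      simp only [LinkPat.Crosses]
      split_ifs <;> omega
    rw [Finset.sum_congr rfl hsum]
    have hpair : LinkPat.Crosses (i', i) (j', j) := ⟨hij', hji, hij⟩
    have h1 : ¬ LinkPat.Crosses (i', j') (i, j) := fun h => absurd h.2.1 hji.asymm
    have h2 : ¬ LinkPat.Crosses (i, j) (i', j') := fun h => absurd h.1 (hij'.trans hji).asymm
    have h3 : ¬ LinkPat.Crosses (j', j) (i', i) := fun h => absurd h.1 hij'.asymm
    have h4 (x : Fin n × Fin n) : ¬ LinkPat.Crosses x x := fun h => lt_irrefl _ h.1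
    rw [if_pos hpair, if_neg h1, if_neg h2, if_neg h3]
    simp only [if_neg (h4 _)]
    ring
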